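/- arXiv:2008.10296 — 2 statements merged into one kernel-verified Lean document; each statement's English description precedes it below -/
import Mathlib

section
/- Let n ≥ 1, let Σ be a symmetric positive definite n×n real matrix with symmetric positive definite square root S (S² = Σ), let A be a symmetric n×n real matrix, b ∈ ℝⁿ, and let μ_rate, μ_base ∈ ℝⁿ with A·μ_rate ≠ 0. For r ∈ ℝ set μ(r) = r·μ_rate + μ_base and define m̄₂(r) = 2·tr((S A S)²) + bᵀΣb + 4·bᵀΣAμ(r) + 4·μ(r)ᵀAΣAμ(r) and m̄₃(r) = 8·tr((S A S)³) + 6·bᵀΣAΣb + 24·bᵀΣAΣAμ(r) + 24·μ(r)ᵀAΣAΣAμ(r). Then m̄₃(r)/m̄₂(r)^{3/2} tends to 0 as r → +∞ and as r → −∞. -/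
open Matrix Filter

theorem tendsto_quadratic_div_sq {l : Filter ℝ} (hl : Tendsto (fun r : ℝ => r⁻¹) l (nhds 0))
    (hne : ∀ᶠ r : ℝ in l, r ≠ 0) (p₀ p₁ p₂ : ℝ) :
    Tendsto (fun r : ℝ => (p₀ + p₁ * r + p₂ * r ^ 2) / r ^ 2) l (nhds p₂) := by
  have h : Tendsto (fun r : ℝ => p₀ * r⁻¹ ^ 2 + p₁ * r⁻¹ + p₂) l
      (nhds (p₀ * 0 ^ 2 + p₁ * 0 + p₂)) :=
    (((hl.pow 2).const_mul p₀).add (hl.const_mul p₁)).add_const p₂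
  simp only [ne_eq, OfNat.ofNat_ne_zero, not_false_eq_true, zero_pow, mul_zero, zero_add] at h
  refine h.congr' ?_
  filter_upwards [hne] with r hr
  field_simp

/-- A quadratic divided by the `3/2` power of a quadratic with positive leading coefficient
vanishes at infinity. -/
theorem tendsto_quadratic_div_quadratic_rpow {l : Filter ℝ}
    (hl : Tendsto (fun r : ℝ => r⁻¹) l (nhds 0)) (hne : ∀ᶠ r : ℝ in l, r ≠ 0)
    (p₀ p₁ p₂ q₀ q₁ q₂ : ℝ) (hp₂ : 0 < p₂) :
    Tendsto (fun r : ℝ => (q₀ + q₁ * r + q₂ * r ^ 2) /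
      (p₀ + p₁ * r + p₂ * r ^ 2) ^ ((3 : ℝ) / 2)) l (nhds 0) := by
  have hp := tendsto_quadratic_div_sq hl hne p₀ p₁ p₂
  have hq := tendsto_quadratic_div_sq hl hne q₀ q₁ q₂
  have hpow := hp.rpow_const (p := (3 : ℝ) / 2) (Or.inl hp₂.ne')
  have h := (hq.div hpow (Real.rpow_pos_of_pos hp₂ _).ne').mul hl.abs
  rw [abs_zero, mul_zero] at h
  refine h.congr' ?_
  filter_upwards [hne, hp.eventually (lt_mem_nhds hp₂)] with r hr hpos
  have hr' : 0 < |r| := abs_pos.mpr hr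
  have hcube : (r ^ 2) ^ ((3 : ℝ) / 2) = |r| ^ 3 := by
    rw [← sq_abs, ← Real.rpow_natCast_mul hr'.le, ← Real.rpow_natCast]
    norm_num
  have hsplit : (p₀ + p₁ * r + p₂ * r ^ 2) ^ ((3 : ℝ) / 2) =
      ((p₀ + p₁ * r + p₂ * r ^ 2) / r ^ 2) ^ ((3 : ℝ) / 2) * |r| ^ 3 := by
    rw [← hcube, ← Real.mul_rpow hpos.le (sq_nonneg r), div_mul_cancel₀ _ (pow_ne_zero 2 hr)]
  have hD := (Real.rpow_pos_of_pos hpos ((3 : ℝ) / 2)).ne'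
  simp only [Pi.div_apply]
  rw [hsplit, abs_inv]
  generalize ((p₀ + p₁ * r + p₂ * r ^ 2) / r ^ 2) ^ ((3 : ℝ) / 2) = D at hD ⊢
  rw [← sq_abs r]
  field_simp

theorem dotProduct_mulVec_smul_add {n : ℕ} (M : Matrix (Fin n) (Fin n) ℝ) (u v : Fin n → ℝ)
    (r : ℝ) :
    (r • u + v) ⬝ᵥ M *ᵥ (r • u + v) =
      v ⬝ᵥ M *ᵥ v + (u ⬝ᵥ M *ᵥ v + v ⬝ᵥ M *ᵥ u) * r + (u ⬝ᵥ M *ᵥ u) * r ^ 2 := by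
  simp only [mulVec_add, mulVec_smul, dotProduct_add, add_dotProduct, smul_dotProduct,
    dotProduct_smul, smul_eq_mul]
  ring

theorem tendsto_quadraticForm_div_quadraticForm_rpow {l : Filter ℝ}
    (hl : Tendsto (fun r : ℝ => r⁻¹) l (nhds 0)) (hne : ∀ᶠ r : ℝ in l, r ≠ 0) {n : ℕ}
    (M N : Matrix (Fin n) (Fin n) ℝ) (c d u v : Fin n → ℝ) (s t : ℝ)
    (hM : 0 < u ⬝ᵥ M *ᵥ u) :
    Tendsto (fun r : ℝ =>
      (t + 24 * (d ⬝ᵥ (r • u + v)) + 24 * ((r • u + v) ⬝ᵥ N *ᵥ (r • u + v))) /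
      (s + 4 * (c ⬝ᵥ (r • u + v)) + 4 * ((r • u + v) ⬝ᵥ M *ᵥ (r • u + v))) ^ ((3 : ℝ) / 2))
      l (nhds 0) := by
  refine (tendsto_quadratic_div_quadratic_rpow hl hne
    (s + 4 * (c ⬝ᵥ v) + 4 * (v ⬝ᵥ M *ᵥ v))
    (4 * (c ⬝ᵥ u) + 4 * (u ⬝ᵥ M *ᵥ v + v ⬝ᵥ M *ᵥ u)) (4 * (u ⬝ᵥ M *ᵥ u))
    (t + 24 * (d ⬝ᵥ v) + 24 * (v ⬝ᵥ N *ᵥ v))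
    (24 * (d ⬝ᵥ u) + 24 * (u ⬝ᵥ N *ᵥ v + v ⬝ᵥ N *ᵥ u)) (24 * (u ⬝ᵥ N *ᵥ u))
    (by positivity)).congr fun r => ?_
  simp only [dotProduct_mulVec_smul_add, dotProduct_add, dotProduct_smul, smul_eq_mul]
  congr 1
  · ring
  · congr 1
    ring

/-- The skewness of the LOO-CV error vanishes as the outlier magnitude grows to `±∞`:
with `μ(r) = r μ_rate + μ_base`, `A μ_rate ≠ 0`, the ratio `m̄₃(r)/m̄₂(r)^{3/2}` tends
to `0` as `r → +∞` and as `r → -∞`. -/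
theorem stmt13 (n : ℕ) (hn : 1 ≤ n)
    (Sig S A : Matrix (Fin n) (Fin n) ℝ)
    (hSigSymm : Sig.IsSymm) (hSigPD : Sig.PosDef)
    (hSSymm : S.IsSymm) (hSPD : S.PosDef) (hSq : S * S = Sig)
    (hASymm : A.IsSymm)
    (b μrate μbase : Fin n → ℝ) (hμrate : A.mulVec μrate ≠ 0)
    (μ : ℝ → Fin n → ℝ) (hμ : ∀ r, μ r = r • μrate + μbase)
    (m2 m3 : ℝ → ℝ)
    (hm2 : ∀ r, m2 r = 2 * ((S * A * S) ^ 2).trace + b ⬝ᵥ Sig.mulVec b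
        + 4 * (b ⬝ᵥ (Sig * A).mulVec (μ r)) + 4 * (μ r ⬝ᵥ (A * Sig * A).mulVec (μ r)))
    (hm3 : ∀ r, m3 r = 8 * ((S * A * S) ^ 3).trace
        + 6 * (b ⬝ᵥ (Sig * A * Sig).mulVec b)
        + 24 * (b ⬝ᵥ (Sig * A * Sig * A).mulVec (μ r))
        + 24 * (μ r ⬝ᵥ (A * Sig * A * Sig * A).mulVec (μ r))) :
    Tendsto (fun r => m3 r / m2 r ^ ((3 : ℝ) / 2)) atTop (nhds 0) ∧
    Tendsto (fun r => m3 r / m2 r ^ ((3 : ℝ) / 2)) atBot (nhds 0) := by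
  have hpos : 0 < μrate ⬝ᵥ (A * Sig * A) *ᵥ μrate := by
    have h := hSigPD.dotProduct_mulVec_pos hμrate
    rw [star_trivial, mulVec_mulVec, dotProduct_comm, dotProduct_mulVec, ← mulVec_transpose,
      hASymm.eq, mulVec_mulVec, dotProduct_comm, ← Matrix.mul_assoc] at h
    exact h
  simp only [hm2, hm3, hμ, dotProduct_mulVec b (Sig * A), dotProduct_mulVec b (Sig * A * Sig * A)]
  exact ⟨tendsto_quadraticForm_div_quadraticForm_rpow tendsto_inv_atTop_zero
      (eventually_ne_atTop 0) _ _ _ _ _ _ _ _ hpos,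
    tendsto_quadraticForm_div_quadraticForm_rpow tendsto_inv_atBot_zero
      (eventually_ne_atBot 0) _ _ _ _ _ _ _ _ hpos⟩
end

section
/- Fix real numbers β₁, m⋆ and s⋆ > 0, and for integers n ≥ 3 define the numerator N(n) = −(3n⁴(2n+1)/((n+2)(n−1)³))·β₁²·s⋆⁴ − (6n³(2n+1)/((n+2)(n−1)³))·β₁·m⋆·s⋆⁴ − (3n²(2n² − 5n − 2)/((n−2)²(n−1)²(n+2)))·m⋆²·s⋆⁴ − (n⁴(8n⁶ + 12n⁵ − 35n⁴ − 102n³ − 83n² − 36n + 20)/((n+2)³(n+1)³(n−1)²(n−2)²))·s⋆⁶ and the denominator D(n) = ( (n³/(n−1)²)·β₁²·s⋆² + (2n²/(n−1)²)·β₁·m⋆·s⋆² + (n/((n−1)(n−2)))·m⋆²·s⋆² + (n³(4n³ + 9n² + 5n − 6)/(2(n+2)²(n+1)²(n−1)(n−2)))·s⋆⁴ )^{3/2}. Then: if β₁ = 0, N(n)/D(n) tends to −2^{3/2} as n → ∞; and if β₁ ≠ 0, N(n)/D(n) tends to 0 as n → ∞. -/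
open Filter

/-- A sequence that is eventually a function of `1 / n` converges to the value of that function
at `0`, provided the function is continuous there. -/
lemma tendsto_of_eq_comp_inv {f : ℕ → ℝ} {g : ℝ → ℝ} {a : ℝ} (hg : ContinuousAt g 0)
    (ha : g 0 = a) (hfg : ∀ n : ℕ, 3 ≤ n → f n = g ((n : ℝ)⁻¹)) :
    Tendsto f atTop (nhds a) := by
  have h : Tendsto (fun n : ℕ => g ((n : ℝ)⁻¹)) atTop (nhds a) :=
    ha ▸ hg.tendsto.comp tendsto_inv_atTop_nhds_zero_nat
  refine h.congr' ?_
  filter_upwards [eventually_ge_atTop 3] with n hn using (hfg n hn).symm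

lemma tendsto_numCoeff_effect :
    Tendsto (fun n : ℕ => 3 * (n : ℝ) ^ 3 * (2 * (n : ℝ) + 1) / (((n : ℝ) + 2) * ((n : ℝ) - 1) ^ 3)) atTop (nhds 6) := by
  refine tendsto_of_eq_comp_inv (g := fun t => 3 * (2 + t) / ((1 + 2 * t) * (1 - t) ^ 3))
    ?_ (by norm_num) ?_
  · fun_prop (disch := norm_num)
  · intro n hn
    have h3 : (3 : ℝ) ≤ n := by exact_mod_cast hn
    have h0 : (n : ℝ) ≠ 0 := ne_of_gt (by linarith)
    have h1 : (n : ℝ) - 1 ≠ 0 := ne_of_gt (by linarith)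
    have h2 : (n : ℝ) - 2 ≠ 0 := ne_of_gt (by linarith)
    field_simp

lemma tendsto_numCoeff_cross :
    Tendsto (fun n : ℕ => 6 * (n : ℝ) ^ 3 * (2 * (n : ℝ) + 1) / (((n : ℝ) + 2) * ((n : ℝ) - 1) ^ 3)) atTop (nhds 12) := by
  refine tendsto_of_eq_comp_inv (g := fun t => 6 * (2 + t) / ((1 + 2 * t) * (1 - t) ^ 3))
    ?_ (by norm_num) ?_
  · fun_prop (disch := norm_num)
  · intro n hn
    have h3 : (3 : ℝ) ≤ n := by exact_mod_cast hn
    have h0 : (n : ℝ) ≠ 0 := ne_of_gt (by linarith)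
    have h1 : (n : ℝ) - 1 ≠ 0 := ne_of_gt (by linarith)
    have h2 : (n : ℝ) - 2 ≠ 0 := ne_of_gt (by linarith)
    field_simp

lemma tendsto_numCoeff_outlier :
    Tendsto (fun n : ℕ => 3 * (n : ℝ) ^ 2 * (2 * (n : ℝ) ^ 2 - 5 * (n : ℝ) - 2)
        / (((n : ℝ) - 2) ^ 2 * ((n : ℝ) - 1) ^ 2 * ((n : ℝ) + 2))) atTop (nhds 0) := by
  refine tendsto_of_eq_comp_inv (g := fun t => 3 * t * (2 - 5 * t - 2 * t ^ 2)
      / ((1 - 2 * t) ^ 2 * (1 - t) ^ 2 * (1 + 2 * t)))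
    ?_ (by norm_num) ?_
  · fun_prop (disch := norm_num)
  · intro n hn
    have h3 : (3 : ℝ) ≤ n := by exact_mod_cast hn
    have h0 : (n : ℝ) ≠ 0 := ne_of_gt (by linarith)
    have h1 : (n : ℝ) - 1 ≠ 0 := ne_of_gt (by linarith)
    have h2 : (n : ℝ) - 2 ≠ 0 := ne_of_gt (by linarith)
    field_simp

lemma tendsto_numCoeff_noise :
    Tendsto (fun n : ℕ => (n : ℝ) ^ 4 * (8 * (n : ℝ) ^ 6 + 12 * (n : ℝ) ^ 5 - 35 * (n : ℝ) ^ 4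
          - 102 * (n : ℝ) ^ 3 - 83 * (n : ℝ) ^ 2 - 36 * (n : ℝ) + 20)
        / (((n : ℝ) + 2) ^ 3 * ((n : ℝ) + 1) ^ 3 * ((n : ℝ) - 1) ^ 2 * ((n : ℝ) - 2) ^ 2)) atTop (nhds 8) := by
  refine tendsto_of_eq_comp_inv (g := fun t => (8 + 12 * t - 35 * t ^ 2 - 102 * t ^ 3 - 83 * t ^ 4 - 36 * t ^ 5 + 20 * t ^ 6)
      / ((1 + 2 * t) ^ 3 * (1 + t) ^ 3 * (1 - t) ^ 2 * (1 - 2 * t) ^ 2))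
    ?_ (by norm_num) ?_
  · fun_prop (disch := norm_num)
  · intro n hn
    have h3 : (3 : ℝ) ≤ n := by exact_mod_cast hn
    have h0 : (n : ℝ) ≠ 0 := ne_of_gt (by linarith)
    have h1 : (n : ℝ) - 1 ≠ 0 := ne_of_gt (by linarith)
    have h2 : (n : ℝ) - 2 ≠ 0 := ne_of_gt (by linarith)
    field_simp

lemma tendsto_denCoeff_effect :
    Tendsto (fun n : ℕ => (n : ℝ) ^ 2 / ((n : ℝ) - 1) ^ 2) atTop (nhds 1) := by
  refine tendsto_of_eq_comp_inv (g := fun t => 1 / (1 - t) ^ 2)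
    ?_ (by norm_num) ?_
  · fun_prop (disch := norm_num)
  · intro n hn
    have h3 : (3 : ℝ) ≤ n := by exact_mod_cast hn
    have h0 : (n : ℝ) ≠ 0 := ne_of_gt (by linarith)
    have h1 : (n : ℝ) - 1 ≠ 0 := ne_of_gt (by linarith)
    have h2 : (n : ℝ) - 2 ≠ 0 := ne_of_gt (by linarith)
    field_simp

lemma tendsto_denCoeff_cross :
    Tendsto (fun n : ℕ => 2 * (n : ℝ) ^ 2 / ((n : ℝ) - 1) ^ 2) atTop (nhds 2) := by
  refine tendsto_of_eq_comp_inv (g := fun t => 2 / (1 - t) ^ 2)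
    ?_ (by norm_num) ?_
  · fun_prop (disch := norm_num)
  · intro n hn
    have h3 : (3 : ℝ) ≤ n := by exact_mod_cast hn
    have h0 : (n : ℝ) ≠ 0 := ne_of_gt (by linarith)
    have h1 : (n : ℝ) - 1 ≠ 0 := ne_of_gt (by linarith)
    have h2 : (n : ℝ) - 2 ≠ 0 := ne_of_gt (by linarith)
    field_simp

lemma tendsto_denCoeff_outlier :
    Tendsto (fun n : ℕ => (n : ℝ) / (((n : ℝ) - 1) * ((n : ℝ) - 2))) atTop (nhds 0) := by
  refine tendsto_of_eq_comp_inv (g := fun t => t / ((1 - t) * (1 - 2 * t)))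
    ?_ (by norm_num) ?_
  · fun_prop (disch := norm_num)
  · intro n hn
    have h3 : (3 : ℝ) ≤ n := by exact_mod_cast hn
    have h0 : (n : ℝ) ≠ 0 := ne_of_gt (by linarith)
    have h1 : (n : ℝ) - 1 ≠ 0 := ne_of_gt (by linarith)
    have h2 : (n : ℝ) - 2 ≠ 0 := ne_of_gt (by linarith)
    field_simp

lemma tendsto_denCoeff_noise :
    Tendsto (fun n : ℕ => (n : ℝ) ^ 3 * (4 * (n : ℝ) ^ 3 + 9 * (n : ℝ) ^ 2 + 5 * (n : ℝ) - 6)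
        / (2 * ((n : ℝ) + 2) ^ 2 * ((n : ℝ) + 1) ^ 2 * ((n : ℝ) - 1) * ((n : ℝ) - 2))) atTop (nhds 2) := by
  refine tendsto_of_eq_comp_inv (g := fun t => (4 + 9 * t + 5 * t ^ 2 - 6 * t ^ 3)
      / (2 * (1 + 2 * t) ^ 2 * (1 + t) ^ 2 * (1 - t) * (1 - 2 * t)))
    ?_ (by norm_num) ?_
  · fun_prop (disch := norm_num)
  · intro n hn
    have h3 : (3 : ℝ) ≤ n := by exact_mod_cast hn
    have h0 : (n : ℝ) ≠ 0 := ne_of_gt (by linarith)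
    have h1 : (n : ℝ) - 1 ≠ 0 := ne_of_gt (by linarith)
    have h2 : (n : ℝ) - 2 ≠ 0 := ne_of_gt (by linarith)
    field_simp

/-- Asymptotic skewness of the LOO-CV error in the one-covariate case (Proposition 5):
if `β₁ = 0` the skewness converges to `-2^{3/2}`, and if `β₁ ≠ 0` it converges to `0`. -/
theorem stmt19 (β1 ms ss : ℝ) (hss : 0 < ss)
    (N D : ℕ → ℝ)
    (hN : ∀ n : ℕ, 3 ≤ n → N n =
      -((3 * (n : ℝ) ^ 4 * (2 * (n : ℝ) + 1) / (((n : ℝ) + 2) * ((n : ℝ) - 1) ^ 3))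
          * β1 ^ 2 * ss ^ 4)
        - (6 * (n : ℝ) ^ 3 * (2 * (n : ℝ) + 1) / (((n : ℝ) + 2) * ((n : ℝ) - 1) ^ 3))
          * β1 * ms * ss ^ 4
        - (3 * (n : ℝ) ^ 2 * (2 * (n : ℝ) ^ 2 - 5 * (n : ℝ) - 2)
            / (((n : ℝ) - 2) ^ 2 * ((n : ℝ) - 1) ^ 2 * ((n : ℝ) + 2)))
          * ms ^ 2 * ss ^ 4
        - ((n : ℝ) ^ 4 * (8 * (n : ℝ) ^ 6 + 12 * (n : ℝ) ^ 5 - 35 * (n : ℝ) ^ 4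
              - 102 * (n : ℝ) ^ 3 - 83 * (n : ℝ) ^ 2 - 36 * (n : ℝ) + 20)
            / (((n : ℝ) + 2) ^ 3 * ((n : ℝ) + 1) ^ 3 * ((n : ℝ) - 1) ^ 2 * ((n : ℝ) - 2) ^ 2))
          * ss ^ 6)
    (hD : ∀ n : ℕ, 3 ≤ n → D n =
      (((n : ℝ) ^ 3 / ((n : ℝ) - 1) ^ 2) * β1 ^ 2 * ss ^ 2
        + (2 * (n : ℝ) ^ 2 / ((n : ℝ) - 1) ^ 2) * β1 * ms * ss ^ 2
        + ((n : ℝ) / (((n : ℝ) - 1) * ((n : ℝ) - 2))) * ms ^ 2 * ss ^ 2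
        + ((n : ℝ) ^ 3 * (4 * (n : ℝ) ^ 3 + 9 * (n : ℝ) ^ 2 + 5 * (n : ℝ) - 6)
            / (2 * ((n : ℝ) + 2) ^ 2 * ((n : ℝ) + 1) ^ 2 * ((n : ℝ) - 1) * ((n : ℝ) - 2)))
            * ss ^ 4) ^ ((3 : ℝ) / 2)) :
    (β1 = 0 → Tendsto (fun n => N n / D n) atTop (nhds (-(2 : ℝ) ^ ((3 : ℝ) / 2)))) ∧
    (β1 ≠ 0 → Tendsto (fun n => N n / D n) atTop (nhds 0)) := by
  have hnat : Tendsto (fun n : ℕ => ((n : ℝ))⁻¹) atTop (nhds 0) :=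
    tendsto_inv_atTop_nhds_zero_nat
  constructor
  · rintro rfl
    have hnum := (((tendsto_numCoeff_outlier.mul_const (ms ^ 2 * ss ^ 4)).add
      (tendsto_numCoeff_noise.mul_const (ss ^ 6))).neg)
    have hvar := (tendsto_denCoeff_outlier.mul_const (ms ^ 2 * ss ^ 2)).add
      (tendsto_denCoeff_noise.mul_const (ss ^ 4))
    have hpos : (0 : ℝ) < 0 * (ms ^ 2 * ss ^ 2) + 2 * ss ^ 4 := by
      rw [zero_mul, zero_add]; positivity
    have hden := hvar.rpow_const (p := (3 : ℝ) / 2) (Or.inl hpos.ne')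
    have hlim := hnum.div hden (Real.rpow_pos_of_pos hpos _).ne'
    have hss6 : (ss ^ 4) ^ ((3 : ℝ) / 2) = ss ^ 6 := by
      rw [← Real.rpow_natCast, ← Real.rpow_natCast, ← Real.rpow_mul hss.le]
      norm_num
    have h8 : (2 : ℝ) ^ ((3 : ℝ) / 2) * (2 : ℝ) ^ ((3 : ℝ) / 2) = 8 := by
      rw [← Real.rpow_add two_pos]
      norm_num
    have hval : -(0 * (ms ^ 2 * ss ^ 4) + 8 * ss ^ 6)
        / (0 * (ms ^ 2 * ss ^ 2) + 2 * ss ^ 4) ^ ((3 : ℝ) / 2) = -(2 : ℝ) ^ ((3 : ℝ) / 2) := by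
      rw [div_eq_iff (Real.rpow_pos_of_pos hpos _).ne', zero_mul, zero_mul, zero_add, zero_add,
        Real.mul_rpow two_pos.le (by positivity), hss6, ← h8]
      ring
    rw [hval] at hlim
    refine hlim.congr' ?_
    filter_upwards [eventually_ge_atTop 3] with n hn
    rw [hN n hn, hD n hn, Pi.div_apply]
    congr 1
    · ring
    · congr 1
      ring
  · intro hβ
    have hnum := ((((tendsto_numCoeff_effect.mul_const (β1 ^ 2 * ss ^ 4)).add
      ((tendsto_numCoeff_cross.mul_const (β1 * ms * ss ^ 4)).mul hnat)).add
      ((tendsto_numCoeff_outlier.mul_const (ms ^ 2 * ss ^ 4)).mul hnat)).add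
      ((tendsto_numCoeff_noise.mul_const (ss ^ 6)).mul hnat)).neg
    have hvar := (((tendsto_denCoeff_effect.mul_const (β1 ^ 2 * ss ^ 2)).add
      ((tendsto_denCoeff_cross.mul_const (β1 * ms * ss ^ 2)).mul hnat)).add
      ((tendsto_denCoeff_outlier.mul_const (ms ^ 2 * ss ^ 2)).mul hnat)).add
      ((tendsto_denCoeff_noise.mul_const (ss ^ 4)).mul hnat)
    simp only [mul_zero, add_zero, one_mul] at hnum hvar
    have hpos : (0 : ℝ) < β1 ^ 2 * ss ^ 2 := by positivity
    have hden := hvar.rpow_const (p := (3 : ℝ) / 2) (Or.inl hpos.ne')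
    have hroot : Tendsto (fun n : ℕ => ((n : ℝ)⁻¹) ^ ((1 : ℝ) / 2)) atTop (nhds 0) := by
      have h := hnat.rpow_const (p := (1 : ℝ) / 2) (Or.inr (by norm_num))
      rwa [Real.zero_rpow (by norm_num)] at h
    have hlim := (hnum.div hden (Real.rpow_pos_of_pos hpos _).ne').mul hroot
    rw [mul_zero] at hlim
    refine hlim.congr' ?_
    filter_upwards [eventually_ge_atTop 3, hvar.eventually (lt_mem_nhds hpos)] with n hn hv
    have hn0 : (0 : ℝ) < n := by
      have : (3 : ℝ) ≤ n := by exact_mod_cast hn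
      linarith
    have hsplit : (n : ℝ) ^ ((3 : ℝ) / 2) = n * (n : ℝ) ^ ((1 : ℝ) / 2) := by
      rw [← Real.rpow_one_add' hn0.le (by norm_num)]
      norm_num
    have hroot0 : (n : ℝ) ^ ((1 : ℝ) / 2) ≠ 0 := (Real.rpow_pos_of_pos hn0 _).ne'
    have hscale : ∀ a v : ℝ, 0 < v →
        a / v ^ ((3 : ℝ) / 2) * ((n : ℝ)⁻¹) ^ ((1 : ℝ) / 2)
          = n * a / (n * v) ^ ((3 : ℝ) / 2) := by
      intro a v hv
      have hv0 : v ^ ((3 : ℝ) / 2) ≠ 0 := (Real.rpow_pos_of_pos hv _).ne'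
      rw [Real.mul_rpow hn0.le hv.le, hsplit, Real.inv_rpow hn0.le]
      field_simp
    rw [hN n hn, hD n hn, Pi.div_apply, hscale _ _ hv]
    have hcancel : (n : ℝ) * (n : ℝ)⁻¹ = 1 := mul_inv_cancel₀ hn0.ne'
    congr 1
    · linear_combination
        (-((6 * (n : ℝ) ^ 3 * (2 * (n : ℝ) + 1) / (((n : ℝ) + 2) * ((n : ℝ) - 1) ^ 3)) * (β1 * ms * ss ^ 4))
        - (3 * (n : ℝ) ^ 2 * (2 * (n : ℝ) ^ 2 - 5 * (n : ℝ) - 2)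
        / (((n : ℝ) - 2) ^ 2 * ((n : ℝ) - 1) ^ 2 * ((n : ℝ) + 2))) * (ms ^ 2 * ss ^ 4)
        - ((n : ℝ) ^ 4 * (8 * (n : ℝ) ^ 6 + 12 * (n : ℝ) ^ 5 - 35 * (n : ℝ) ^ 4
          - 102 * (n : ℝ) ^ 3 - 83 * (n : ℝ) ^ 2 - 36 * (n : ℝ) + 20)
        / (((n : ℝ) + 2) ^ 3 * ((n : ℝ) + 1) ^ 3 * ((n : ℝ) - 1) ^ 2 * ((n : ℝ) - 2) ^ 2)) * ss ^ 6) * hcancel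
    · congr 1
      linear_combination
        ((2 * (n : ℝ) ^ 2 / ((n : ℝ) - 1) ^ 2) * (β1 * ms * ss ^ 2)
        + ((n : ℝ) / (((n : ℝ) - 1) * ((n : ℝ) - 2))) * (ms ^ 2 * ss ^ 2)
        + ((n : ℝ) ^ 3 * (4 * (n : ℝ) ^ 3 + 9 * (n : ℝ) ^ 2 + 5 * (n : ℝ) - 6)
        / (2 * ((n : ℝ) + 2) ^ 2 * ((n : ℝ) + 1) ^ 2 * ((n : ℝ) - 1) * ((n : ℝ) - 2))) * ss ^ 4) * hcancel
end
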